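/- For every integer m ≥ 5 with m ≡ 2 (mod 3), n_m ≤ (13/27)·(m-2)^{m-2}. -/

import Mathlib

/-- A graph `G` is `k`-choosable if for every assignment of lists of `k` colors
to the vertices there is a proper coloring choosing each vertex's color from its list. -/
def Choosable {V : Type*} (G : SimpleGraph V) (k : ℕ) : Prop :=
  ∀ L : V → Finset ℕ, (∀ v, (L v).card = k) →
    ∃ c : V → ℕ, (∀ v, c v ∈ L v) ∧ ∀ u w, G.Adj u w → c u ≠ c w

/-- The choice number of `G` is the least `k` such that `G` is `k`-choosable. -/
noncomputable def choiceNumber {V : Type*} (G : SimpleGraph V) : ℕ :=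
  sInf {k | Choosable G k}

/-- `nm m` is the smallest integer `n` such that `ch (K_{m,n}) = m - 1`. -/
noncomputable def nm (m : ℕ) : ℕ :=
  sInf {n | choiceNumber (completeBipartiteGraph (Fin m) (Fin n)) = m - 1}

/-- Choosability is monotone in the size of the lists. -/
theorem Choosable.mono {V : Type*} {G : SimpleGraph V} {k l : ℕ} (h : Choosable G k)
    (hkl : k ≤ l) : Choosable G l := by
  intro L hL
  choose L' hsub hcard using fun v =>
    Finset.exists_subset_card_eq (s := L v) (n := k) (by rw [hL v]; exact hkl)
  obtain ⟨c, hc, hadj⟩ := h L' hcard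
  exact ⟨c, fun v => hsub v (hc v), hadj⟩

/-- The choice number is `k + 1` once `G` is `(k + 1)`-choosable but not `k`-choosable. -/
theorem choiceNumber_eq_succ {V : Type*} {G : SimpleGraph V} {k : ℕ}
    (h : Choosable G (k + 1)) (h' : ¬ Choosable G k) : choiceNumber G = k + 1 := by
  refine le_antisymm (Nat.sInf_le h) (le_csInf ⟨_, h⟩ fun l hl => ?_)
  by_contra! hlt
  exact h' (Choosable.mono hl (by omega))

/-- Adding a vertex to one side of a complete bipartite graph costs at most one color. -/
theorem Choosable.completeBipartiteGraph_succ {m n k : ℕ}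
    (h : Choosable (completeBipartiteGraph (Fin m) (Fin n)) k) :
    Choosable (completeBipartiteGraph (Fin m) (Fin (n + 1))) (k + 1) := by
  intro L hL
  obtain ⟨x, hx⟩ : (L (Sum.inr (Fin.last n))).Nonempty := by
    rw [← Finset.card_pos, hL]; omega
  choose L' hsub hcard using fun v : Fin m ⊕ Fin n =>
    Finset.exists_subset_card_eq (s := (L (Sum.map id Fin.castSucc v)).erase x) (n := k) (by
      have := Finset.pred_card_le_card_erase (s := L (Sum.map id Fin.castSucc v)) (a := x)
      rw [hL] at this
      exact this)
  obtain ⟨c, hc, hadj⟩ := h L' hcard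
  have hmem v := Finset.mem_erase.1 (hsub v (hc v))
  have hne : ∀ (i : Fin m) (j : Fin (n + 1)),
      c (Sum.inl i) ≠ Fin.lastCases (motive := fun _ => ℕ) x (fun j => c (Sum.inr j)) j := by
    intro i j
    induction j using Fin.lastCases with
    | last => simpa using (hmem (Sum.inl i)).1
    | cast j => simpa using hadj (Sum.inl i) (Sum.inr j) (by simp)
  refine ⟨Sum.elim (fun i => c (Sum.inl i))
    (Fin.lastCases (motive := fun _ => ℕ) x fun j => c (Sum.inr j)), ?_, ?_⟩
  · rintro (i | j)
    · exact (hmem (Sum.inl i)).2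
    · induction j using Fin.lastCases with
      | last => simpa using hx
      | cast j => simpa using (hmem (Sum.inr j)).2
  · rintro (i | j) (i' | j') hij
    · simp at hij
    · exact hne i j'
    · exact (hne i' j).symm
    · simp at hij

theorem choosable_completeBipartiteGraph_zero {m k : ℕ} (hk : 0 < k) :
    Choosable (completeBipartiteGraph (Fin m) (Fin 0)) k := by
  intro L hL
  choose c hc using fun v => Finset.card_pos.1 ((hL v).symm ▸ hk)
  refine ⟨c, hc, ?_⟩
  rintro (i | i) (j | j) hij
  · simp at hij
  · exact j.elim0
  · exact i.elim0
  · exact i.elim0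

/-- If `K_{m,n}` is not `(m - 2)`-choosable, then `n` bounds `nm m`. -/
theorem nm_le_of_not_choosable {k n : ℕ} (hk : 0 < k)
    (h : ¬ Choosable (completeBipartiteGraph (Fin (k + 2)) (Fin n)) k) : nm (k + 2) ≤ n := by
  classical
  have hex : ∃ n, ¬ Choosable (completeBipartiteGraph (Fin (k + 2)) (Fin n)) k := ⟨n, h⟩
  refine le_trans (Nat.sInf_le ?_) (Nat.find_min' hex h)
  have hspec := Nat.find_spec hex
  have hmin := fun {l} => Nat.find_min hex (m := l)
  generalize Nat.find hex = N at hspec hmin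
  cases N with
  | zero => exact absurd (choosable_completeBipartiteGraph_zero hk) hspec
  | succ N =>
    exact choiceNumber_eq_succ (not_not.1 (hmin N.lt_succ_self)).completeBipartiteGraph_succ hspec

/-- Lists `A` on one side and `B` on the other, over any countable set of colors, such that every
choice of colors from the lists in `A` exhausts some list in `B`, witness non-choosability. -/
theorem not_choosable_of_lists {α β γ : Type*} [Fintype α] [Fintype β] [Encodable γ]
    {m n k : ℕ} (hα : Fintype.card α = m) (hβ : Fintype.card β = n)
    (A : α → Finset γ) (B : β → Finset γ) (hA : ∀ a, (A a).card = k) (hB : ∀ b, (B b).card = k)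
    (h : ∀ c : α → γ, (∀ a, c a ∈ A a) → ∃ b, ∀ x ∈ B b, ∃ a, c a = x) :
    ¬ Choosable (completeBipartiteGraph (Fin m) (Fin n)) k := by
  intro hch
  let e := Fintype.equivFinOfCardEq hα
  let e' := Fintype.equivFinOfCardEq hβ
  let f : γ ↪ ℕ := ⟨Encodable.encode, Encodable.encode_injective⟩
  obtain ⟨c, hc, hadj⟩ := hch
    (Sum.elim (fun i => (A (e.symm i)).map f) (fun j => (B (e'.symm j)).map f))
    (by rintro (i | j) <;> simp [hA, hB])
  have hcA : ∀ a, ∃ x ∈ A a, f x = c (Sum.inl (e a)) := by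
    intro a
    simpa using hc (Sum.inl (e a))
  choose d hd hdc using hcA
  obtain ⟨b, hb⟩ := h d hd
  obtain ⟨x, hx, hxc⟩ : ∃ x ∈ B b, f x = c (Sum.inr (e' b)) := by
    simpa using hc (Sum.inr (e' b))
  obtain ⟨a, rfl⟩ := hb x hx
  exact hadj (Sum.inl (e a)) (Sum.inr (e' b)) (by simp) ((hdc a).symm.trans hxc)

/-- Five triples of colors; together with `thirteenTriples` they show that `K_{5,13}` is not
`3`-choosable. -/
def fiveTriples : Fin 5 → Fin 3 → Fin 9 :=
  ![![4, 5, 6], ![0, 2, 3], ![1, 6, 8], ![5, 7, 8], ![1, 4, 7]]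

/-- Thirteen triples of colors such that every choice of one color from each of the `fiveTriples`
contains one of them. -/
def thirteenTriples : Fin 13 → Fin 3 → Fin 9 :=
  ![![0, 1, 5], ![1, 2, 5], ![1, 3, 5], ![0, 6, 7], ![2, 6, 7], ![3, 6, 7], ![0, 4, 8],
    ![2, 4, 8], ![3, 4, 8], ![4, 5, 6], ![1, 4, 7], ![1, 6, 8], ![5, 7, 8]]

theorem fiveTriples_injective (a : Fin 5) : Function.Injective (fiveTriples a) := by
  revert a; decide

theorem thirteenTriples_injective (b : Fin 13) : Function.Injective (thirteenTriples b) := by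
  revert b; decide

set_option maxRecDepth 100000 in
theorem exists_thirteenTriples_subset (c : Fin 5 → Fin 3) :
    ∃ b, ∀ i, ∃ a, fiveTriples a (c a) = thirteenTriples b i := by
  have key : ∀ c₀ c₁ c₂ c₃ c₄ : Fin 3, ∃ b, ∀ i, ∃ a,
      fiveTriples a (![c₀, c₁, c₂, c₃, c₄] a) = thirteenTriples b i := by
    decide
  have hc : c = ![c 0, c 1, c 2, c 3, c 4] := by
    ext a; fin_cases a <;> rfl
  rw [hc]
  exact key _ _ _ _ _

/-- Blow up the colors of the `fiveTriples` construction by a factor `t`, and add `r` disjoint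
lists of size `k = 3 t`. -/
theorem not_choosable_blowup {t r k : ℕ} (hk : k = 3 * t) (hr : k = 3 + r) :
    ¬ Choosable (completeBipartiteGraph (Fin (k + 2)) (Fin (13 * t ^ 3 * k ^ r))) k := by
  refine not_choosable_of_lists (α := Fin 5 ⊕ Fin r)
    (β := (Fin 13 × (Fin 3 → Fin t)) × (Fin r → Fin k))
    (γ := (Fin 9 × Fin t) ⊕ (Fin r × Fin k))
    (by simp; omega) (by simp)
    (Sum.elim (fun a => ((Finset.univ.image (fiveTriples a)) ×ˢ Finset.univ).disjSum ∅)
      (fun j => (∅ : Finset (Fin 9 × Fin t)).disjSum ({j} ×ˢ Finset.univ)))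
    (fun b => (Finset.univ.image fun i => (thirteenTriples b.1.1 i, b.1.2 i)).disjSum
      (Finset.univ.image fun j => (j, b.2 j))) ?_ ?_ ?_
  · rintro (a | j)
    · simp [Finset.card_image_of_injective _ (fiveTriples_injective a), hk]
    · simp
  · rintro ⟨⟨b, f⟩, g⟩
    have h₁ : Function.Injective fun i => (thirteenTriples b i, f i) := fun i j hij =>
      thirteenTriples_injective b (Prod.ext_iff.1 hij).1
    have h₂ : Function.Injective fun j => (j, g j) := fun i j hij => (Prod.ext_iff.1 hij).1
    simp [Finset.card_image_of_injective _ h₁, Finset.card_image_of_injective _ h₂, hr]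
  · intro c hc
    have hl : ∀ a, ∃ (i : Fin 3) (s : Fin t), c (Sum.inl a) = Sum.inl (fiveTriples a i, s) := by
      intro a
      have := hc (Sum.inl a)
      rcases hca : c (Sum.inl a) with ⟨x, s⟩ | y
      · simp only [hca, Sum.elim_inl, Finset.inl_mem_disjSum, Finset.mem_product,
          Finset.mem_image, Finset.mem_univ, true_and, and_true] at this
        obtain ⟨i, rfl⟩ := this
        exact ⟨i, s, rfl⟩
      · simp [hca] at this
    have hrt : ∀ j, ∃ s : Fin k, c (Sum.inr j) = Sum.inr (j, s) := by
      intro j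
      have := hc (Sum.inr j)
      rcases hcj : c (Sum.inr j) with y | ⟨x, s⟩
      · simp [hcj] at this
      · simp [hcj] at this
        exact ⟨s, by rw [this]⟩
    choose i s his using hl
    choose g hg using hrt
    obtain ⟨b, hb⟩ := exists_thirteenTriples_subset i
    choose a ha using hb
    refine ⟨⟨⟨b, fun l => s (a l)⟩, g⟩, ?_⟩
    rintro (x | x) hx
    · simp only [Finset.inl_mem_disjSum, Finset.mem_image, Finset.mem_univ, true_and] at hx
      obtain ⟨l, rfl⟩ := hx
      exact ⟨Sum.inl (a l), by rw [his, ha]⟩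
    · simp only [Finset.inr_mem_disjSum, Finset.mem_image, Finset.mem_univ, true_and] at hx
      obtain ⟨j, rfl⟩ := hx
      exact ⟨Sum.inr j, hg j⟩

/-- For every integer `m ≥ 5` with `m ≡ 2 (mod 3)`, `n_m ≤ (13/27) (m-2)^(m-2)`. -/
theorem nm_le_of_two_mod_three (m : ℕ) (hm : 5 ≤ m) (hmod : m % 3 = 2) :
    (nm m : ℝ) ≤ (13 / 27) * ((m : ℝ) - 2) ^ (m - 2) := by
  obtain ⟨s, rfl⟩ : ∃ s, m = 3 * (s + 1) + 2 := ⟨m / 3 - 1, by omega⟩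
  have h := nm_le_of_not_choosable (by omega)
    (not_choosable_blowup (t := s + 1) (r := 3 * s) rfl (by ring))
  refine (Nat.cast_le (α := ℝ).2 h).trans (le_of_eq ?_)
  rw [Nat.add_sub_cancel, show 3 * (s + 1) = 3 * s + 3 by ring]
  push_cast
  ring
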